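/- arXiv:2105.03130 — 3 statements merged into one kernel-verified Lean document; each statement's English description precedes it below -/
import Mathlib

section
/- Let $(X,\mathcal{B}_X,\mu,T)$ be a $\mathbb{Z}^2$-MPS and $\alpha$ a finite measurable partition of $X$. If there exists an infinite subset $S$ of $\mathbb{Z}^2$ such that $h^S_\mu(T,\alpha)>0$, then there is at most one direction vector $\vec v=(1,\beta)\in\mathbb{R}^2$ such that $h^{\vec v,*}_\mu(\alpha)=0$. -/
open MeasureTheory Filter Set
open scoped ENNReal Topology

namespace Directional

noncomputable section

attribute [local instance] Classical.propDecidable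

variable {X : Type*} [MeasurableSpace X] {G : Type*}

/-- The set of Koopman images `U_T^w 1_B` for `w ∈ Λ`, as elements of `L²(μ)`. -/
def korbit (μ : Measure X) (T : G → X → X) (Λ : Set G) (B : Set X) :
    Set (Lp ℝ 2 μ) :=
  {g | ∃ w ∈ Λ, (g : X → ℝ) =ᵐ[μ] fun x => B.indicator (fun _ => (1 : ℝ)) (T w x)}

/-- A finite measurable partition of `X`. -/
def IsPartition (α : Finset (Set X)) : Prop :=
  (∀ A ∈ α, MeasurableSet A) ∧ ((α : Set (Set X)).PairwiseDisjoint id) ∧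
    ⋃₀ (α : Set (Set X)) = Set.univ

/-- Static entropy `H_μ(α) = -∑ μ(A) log μ(A)`. -/
def partEnt (μ : Measure X) (α : Finset (Set X)) : ℝ :=
  ∑ A ∈ α, Real.negMulLog (μ A).toReal

/-- The join `⋁_{i=1}^k T^{-w_i} α`. -/
def seqJoin (T : G → X → X) (w : ℕ → G) (α : Finset (Set X)) : ℕ → Finset (Set X)
  | 0 => {Set.univ}
  | k + 1 => ((seqJoin T w α k) ×ˢ α).image fun p => p.1 ∩ (T (w k) ⁻¹' p.2)

/-- Sequence entropy `h^S_μ(T, α)` along the sequence `w` for the partition `α`. -/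
def seqEnt (μ : Measure X) (T : G → X → X) (w : ℕ → G) (α : Finset (Set X)) : ℝ :=
  Filter.atTop.limsup fun k : ℕ => partEnt μ (seqJoin T w α k) / (k : ℝ)

/-- Sequence entropy `h^S_μ(T)`, as the supremum over all finite measurable
partitions (valued in `ℝ≥0∞`). -/
def seqEntSup (μ : Measure X) (T : G → X → X) (w : ℕ → G) : ℝ≥0∞ :=
  ⨆ α : {α : Finset (Set X) // IsPartition α}, ENNReal.ofReal (seqEnt μ T w α)

/-- `w : ℕ → G` is an enumeration of an infinite subset of `Λ`. -/
def EnumIn (w : ℕ → G) (Λ : Set G) : Prop :=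
  Function.Injective w ∧ ∀ i, w i ∈ Λ

/-- Conditional entropy `H_μ(α | F)` with respect to a sub-σ-algebra `F`. -/
def condEntAlg (μ : Measure X) (F : MeasurableSpace X) (α : Finset (Set X)) : ℝ :=
  ∑ A ∈ α, ∫ x, Real.negMulLog ((μ[A.indicator (fun _ => (1 : ℝ)) | F]) x) ∂μ

/-- Conditional entropy `H_μ(α | η)` of a partition given another partition. -/
def condEntPart (μ : Measure X) (α η : Finset (Set X)) : ℝ :=
  -∑ A ∈ α, ∑ D ∈ η,
    (μ (A ∩ D)).toReal * Real.log ((μ (A ∩ D)).toReal / (μ D).toReal)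

/-- A `ℤ²`-measure-preserving system: an action of `ℤ²` by homeomorphisms
(continuous maps with continuous inverses `T (-w)`), preserving `μ`. -/
def IsZ2MPS [TopologicalSpace X] (μ : Measure X) (T : ℤ × ℤ → X → X) : Prop :=
  (∀ w, Continuous (T w)) ∧ T 0 = _root_.id ∧ (∀ v w, T (v + w) = T v ∘ T w) ∧
    ∀ w, MeasurePreserving (T w) μ μ

/-- The strip `Λ^{(1,β)}(b) = {(m,n) : βm - b/2 ≤ n ≤ βm + b/2}`. -/
def Lam (β b : ℝ) : Set (ℤ × ℤ) :=
  {p | β * (p.1 : ℝ) - b / 2 ≤ (p.2 : ℝ) ∧ (p.2 : ℝ) ≤ β * (p.1 : ℝ) + b / 2}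

/-- The `(1,β)`-directional Kronecker algebra with width parameter `b`. -/
def dirKron (μ : Measure X) (T : ℤ × ℤ → X → X) (β b : ℝ) : Set (Set X) :=
  {B | MeasurableSet B ∧ IsCompact (closure (korbit μ T (Lam β b) B))}

/-- The directional Kronecker algebra as a σ-algebra (using width `b = 1`,
which is immaterial since `dirKron` is independent of `b`). -/
def dirKronAlg (μ : Measure X) (T : ℤ × ℤ → X → X) (β : ℝ) : MeasurableSpace X :=
  MeasurableSpace.generateFrom (dirKron μ T β 1)

/-- The classical Kronecker algebra of the `ℤ²`-system. -/
def kron (μ : Measure X) (T : ℤ × ℤ → X → X) : Set (Set X) :=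
  {B | MeasurableSet B ∧ IsCompact (closure (korbit μ T Set.univ B))}

/-- `h^{v,*}_μ(α)`: supremum of directional sequence entropies of `α` over all
infinite subsets of the strip (width `1`, immaterial). -/
def hStar (μ : Measure X) (T : ℤ × ℤ → X → X) (β : ℝ) (α : Finset (Set X)) : ℝ :=
  ⨆ w : {w : ℕ → ℤ × ℤ // EnumIn w (Lam β 1)}, seqEnt μ T w.1 α

end

/-- A monotone, translation invariant set function with diminishing increments. -/
structure IsEntropyLike {V : Type*} [AddCommGroup V] [DecidableEq V] (h : Finset V → ℝ) :
    Prop where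
  empty : h ∅ = 0
  mono : ∀ {A B : Finset V}, A ⊆ B → h A ≤ h B
  submod : ∀ {A B : Finset V} (w : V), A ⊆ B → h (insert w B) + h A ≤ h (insert w A) + h B
  translate : ∀ (v : V) (A : Finset V), h (A.image (v + ·)) = h A

/-- `Λ` is null for `h` if the increments of `h` along `Λ` can be made uniformly small. -/
def IsNull {V : Type*} [DecidableEq V] (h : Finset V → ℝ) (Λ : Set V) : Prop :=
  ∀ c : ℝ, 0 < c → ∃ E : Finset V, ∀ w ∈ Λ, h (insert w E) ≤ h E + c

section Combinatorics

variable {V : Type*} [DecidableEq V] {h : Finset V → ℝ}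

/-- Along a set that is not null, one can choose a sequence with linear growth. -/
theorem exists_linear_growth_of_not_isNull (h0 : h ∅ = 0) {Λ : Set V} (hΛ : ¬ IsNull h Λ) :
    ∃ c : ℝ, 0 < c ∧ ∃ w : ℕ → V, EnumIn w Λ ∧
      ∀ k : ℕ, c * k ≤ h ((Finset.range k).image w) := by
  unfold IsNull at hΛ
  push Not at hΛ
  obtain ⟨c, hc, hE⟩ := hΛ
  choose p hp hlt using hE
  let E : ℕ → Finset V := fun k => Nat.rec ∅ (fun _ F => insert (p F) F) k
  have hsucc : ∀ k, E (k + 1) = insert (p (E k)) (E k) := fun k => rfl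
  have himage : ∀ k, (Finset.range k).image (fun i => p (E i)) = E k := by
    intro k
    induction k with
    | zero => rfl
    | succ k ih => rw [Finset.range_add_one, Finset.image_insert, ih, hsucc]
  have hnotMem : ∀ F, p F ∉ F := by
    intro F hF
    have := hlt F
    rw [Finset.insert_eq_of_mem hF] at this
    linarith
  refine ⟨c, hc, fun i => p (E i), ⟨?_, fun i => hp _⟩, fun k => ?_⟩
  · refine Function.Injective.of_lt_imp_ne fun i j hij heq => hnotMem (E j) ?_
    rw [← heq]
    rw [← himage j]
    exact Finset.mem_image_of_mem (fun i => p (E i)) (Finset.mem_range.2 hij)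
  · rw [himage]
    induction k with
    | zero => simp [E, h0]
    | succ k ih =>
      have := hlt (E k)
      rw [hsucc]
      push_cast
      linarith

theorem isNull_coe_finset (D : Finset V) : IsNull h (D : Set V) := fun c hc =>
  ⟨D, fun w hw => by rw [Finset.insert_eq_of_mem (Finset.mem_coe.1 hw)]; linarith⟩

variable [AddCommGroup V]

theorem IsEntropyLike.union_le (H : IsEntropyLike h) {E F : Finset V} {c : ℝ}
    (hF : ∀ f ∈ F, h (insert f E) ≤ h E + c) : h (F ∪ E) ≤ h E + F.card * c := by
  induction F using Finset.induction_on with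
  | empty => simp
  | insert a F ha ih =>
    have h1 := ih fun f hf => hF f (Finset.mem_insert_of_mem hf)
    have h2 := hF a (Finset.mem_insert_self _ _)
    have h3 := H.submod a (Finset.subset_union_right (s₁ := F) (s₂ := E))
    rw [Finset.insert_union, Finset.card_insert_of_notMem ha]
    push_cast
    linarith

theorem IsEntropyLike.singleton (H : IsEntropyLike h) (v : V) : h {v} = h {0} := by
  have := H.translate v {0}
  simpa using this

theorem IsEntropyLike.nonneg (H : IsEntropyLike h) (E : Finset V) : 0 ≤ h E :=
  H.empty ▸ H.mono (Finset.empty_subset E)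

theorem IsEntropyLike.le_card_mul (H : IsEntropyLike h) (E : Finset V) :
    h E ≤ E.card * h {0} := by
  have := H.union_le (E := ∅) (F := E) (c := h {0}) fun f _ => by
    simp [H.empty, H.singleton f]
  simpa [H.empty] using this

open scoped Pointwise in
theorem IsEntropyLike.isNull_add (H : IsEntropyLike h) {Λ₁ Λ₂ : Set V} (h₁ : IsNull h Λ₁)
    (h₂ : IsNull h Λ₂) : IsNull h (Λ₁ + Λ₂) := by
  intro c hc
  obtain ⟨E₂, hE₂⟩ := h₂ (c / 2) (half_pos hc)
  have hn : (0 : ℝ) < E₂.card + 1 := by positivity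
  obtain ⟨E₁, hE₁⟩ := h₁ (c / 2 / (E₂.card + 1)) (by positivity)
  refine ⟨E₁ + E₂, ?_⟩
  rintro _ ⟨v₁, hv₁, v₂, hv₂, rfl⟩
  set E := E₁ + E₂ with hE
  set F := E₂.image (v₁ + ·) with hF
  have hstep : ∀ f ∈ F, h (insert f E) ≤ h E + c / 2 / (E₂.card + 1) := by
    intro f hf
    obtain ⟨e, he, rfl⟩ := Finset.mem_image.1 hf
    have hsub : E₁.image (e + ·) ⊆ E := by
      intro x hx
      obtain ⟨y, hy, rfl⟩ := Finset.mem_image.1 hx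
      exact Finset.mem_add.2 ⟨y, hy, e, he, add_comm _ _⟩
    have h3 := H.submod (v₁ + e) hsub
    have h4 := H.translate e (insert v₁ E₁)
    rw [Finset.image_insert, add_comm e v₁] at h4
    have h5 := H.translate e E₁
    have h6 := hE₁ v₁ hv₁
    linarith
  have hFE := H.union_le hstep
  have hcard : (F.card : ℝ) * (c / 2 / (E₂.card + 1)) ≤ c / 2 := by
    have : (F.card : ℝ) ≤ E₂.card + 1 := by
      have : F.card ≤ E₂.card := Finset.card_image_le
      exact_mod_cast this.trans (Nat.le_succ _)
    calc (F.card : ℝ) * (c / 2 / (E₂.card + 1))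
        ≤ (E₂.card + 1) * (c / 2 / (E₂.card + 1)) := by gcongr
      _ = c / 2 := by field_simp
  have hw : h (insert (v₁ + v₂) F) ≤ h F + c / 2 := by
    have h4 := H.translate v₁ (insert v₂ E₂)
    rw [Finset.image_insert] at h4
    have h5 := H.translate v₁ E₂
    have h6 := hE₂ v₂ hv₂
    linarith
  have hsub := H.submod (v₁ + v₂) (Finset.subset_union_left (s₁ := F) (s₂ := E))
  have hmono : h (insert (v₁ + v₂) E) ≤ h (insert (v₁ + v₂) (F ∪ E)) :=
    H.mono (Finset.insert_subset_insert _ Finset.subset_union_right)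
  change h (insert (v₁ + v₂) E) ≤ h E + c
  linarith

theorem IsEntropyLike.exists_sublinear_bound (H : IsEntropyLike h) (hnull : IsNull h Set.univ)
    {c : ℝ} (hc : 0 < c) : ∃ C : ℝ, ∀ F : Finset V, h F ≤ C + F.card * c := by
  obtain ⟨E, hE⟩ := hnull c hc
  exact ⟨h E, fun F => (H.mono Finset.subset_union_left).trans
    (H.union_le fun f _ => hE f (Set.mem_univ f))⟩

end Combinatorics

section Entropy

open Real

theorem negMulLog_sum_le {ι : Type*} (s : Finset ι) {p : ι → ℝ} (hp : ∀ i ∈ s, 0 ≤ p i) :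
    negMulLog (∑ i ∈ s, p i) ≤ ∑ i ∈ s, negMulLog (p i) := by
  rw [negMulLog, neg_mul, Finset.sum_mul, ← Finset.sum_neg_distrib]
  refine Finset.sum_le_sum fun i hi => ?_
  rw [negMulLog, neg_mul]
  rcases (hp i hi).eq_or_lt with h0 | h0
  · simp [← h0]
  · have := log_le_log h0 (Finset.single_le_sum hp hi)
    nlinarith

theorem mul_log_sub_le {p q r t : ℝ} (hp : 0 ≤ p) (hpq : p ≤ q) (hpr : p ≤ r) (hpt : p ≤ t) :
    p * (log q + log r - log p - log t) ≤ q * r / t - p := by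
  rcases hp.eq_or_lt with h0 | h0
  · subst h0
    simp only [zero_mul, sub_zero]
    positivity
  · have hq := h0.trans_le hpq
    have hr := h0.trans_le hpr
    have ht := h0.trans_le hpt
    have hlog : log (q * r / t / p) = log q + log r - log p - log t := by
      rw [log_div (by positivity) h0.ne', log_div (by positivity) ht.ne',
        log_mul hq.ne' hr.ne']
      ring
    have := log_le_sub_one_of_pos (x := q * r / t / p) (by positivity)
    rw [hlog] at this
    calc p * (log q + log r - log p - log t) ≤ p * (q * r / t / p - 1) := by gcongr
      _ = q * r / t - p := by field_simp

/-- Strong subadditivity of entropy for a finite joint distribution `p`, the third variable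
being a function `φ` of the second one. -/
theorem sum_negMulLog_submod {S S' S'' : Type*} [Fintype S] [Fintype S'] [Fintype S'']
    [DecidableEq S''] (p : S → S' → ℝ) (hp : ∀ x y, 0 ≤ p x y) (φ : S' → S'') :
    (∑ x, ∑ y, negMulLog (p x y)) + ∑ z, negMulLog (∑ y with φ y = z, ∑ x, p x y) ≤
      (∑ x, ∑ z, negMulLog (∑ y with φ y = z, p x y)) + ∑ y, negMulLog (∑ x, p x y) := by
  set q : S → S'' → ℝ := fun x z => ∑ y with φ y = z, p x y with hq
  set r : S' → ℝ := fun y => ∑ x, p x y with hr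
  set t : S'' → ℝ := fun z => ∑ y with φ y = z, r y with ht
  have hr0 : ∀ y, 0 ≤ r y := fun y => Finset.sum_nonneg fun x _ => hp x y
  have htq : ∀ z, ∑ x, q x z = t z := fun z => Finset.sum_comm
  have hpq : ∀ x y, p x y ≤ q x (φ y) := fun x y =>
    Finset.single_le_sum (f := fun y => p x y) (fun y _ => hp x y) (by simp)
  have hpr : ∀ x y, p x y ≤ r y := fun x y =>
    Finset.single_le_sum (f := fun x => p x y) (fun x _ => hp x y) (by simp)
  have hrt : ∀ y, r y ≤ t (φ y) := fun y =>
    Finset.single_le_sum (f := r) (fun y _ => hr0 y) (by simp)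
  have key : ∑ y, ∑ x, p x y * (log (q x (φ y)) + log (r y) - log (p x y) - log (t (φ y))) ≤ 0 := by
    calc _ ≤ ∑ y, ∑ x, (q x (φ y) * r y / t (φ y) - p x y) :=
          Finset.sum_le_sum fun y _ => Finset.sum_le_sum fun x _ =>
            mul_log_sub_le (hp x y) (hpq x y) (hpr x y) ((hpr x y).trans (hrt y))
      _ ≤ 0 := Finset.sum_nonpos fun y _ => ?_
    rw [Finset.sum_sub_distrib, ← Finset.sum_div, ← Finset.sum_mul, htq]
    change t (φ y) * r y / t (φ y) - r y ≤ 0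
    rcases eq_or_ne (t (φ y)) 0 with h0 | h0
    · simp [h0, hr0 y]
    · rw [mul_div_cancel_left₀ _ h0, sub_self]
  have e1 : ∑ x, ∑ y, negMulLog (p x y) = - ∑ y, ∑ x, p x y * log (p x y) := by
    rw [Finset.sum_comm]
    simp [negMulLog]
  have e2 : ∑ z, negMulLog (t z) = - ∑ y, ∑ x, p x y * log (t (φ y)) := by
    simp only [← Finset.sum_mul]
    rw [← Finset.sum_fiberwise Finset.univ φ, ← Finset.sum_neg_distrib]
    refine Finset.sum_congr rfl fun z _ => ?_
    rw [negMulLog, neg_mul, ht, Finset.sum_mul, neg_inj]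
    refine Finset.sum_congr rfl fun y hy => ?_
    rw [(Finset.mem_filter.1 hy).2]
  have e3 : ∑ x, ∑ z, negMulLog (q x z) = - ∑ y, ∑ x, p x y * log (q x (φ y)) := by
    rw [Finset.sum_comm (s := (Finset.univ : Finset S')), ← Finset.sum_neg_distrib]
    refine Finset.sum_congr rfl fun x _ => ?_
    rw [← Finset.sum_fiberwise Finset.univ φ, ← Finset.sum_neg_distrib]
    refine Finset.sum_congr rfl fun z _ => ?_
    rw [negMulLog, neg_mul, hq, Finset.sum_mul, neg_inj]
    refine Finset.sum_congr rfl fun y hy => ?_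
    rw [(Finset.mem_filter.1 hy).2]
  have e4 : ∑ y, negMulLog (r y) = - ∑ y, ∑ x, p x y * log (r y) := by
    simp only [← Finset.sum_mul]
    simp [negMulLog, hr]
  simp only [mul_sub, mul_add, Finset.sum_sub_distrib, Finset.sum_add_distrib] at key
  rw [e1, e2, e3, e4]
  linarith

variable {X : Type*} [MeasurableSpace X] (μ : Measure X)

/-- Entropy of the partition of `X` into the fibres of a map to a finite type. -/
noncomputable def mapEnt {S : Type*} [Fintype S] (f : X → S) : ℝ :=
  ∑ s, negMulLog (μ.real (f ⁻¹' {s}))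

section

variable {S S' S'' : Type*} [Fintype S] [MeasurableSpace S] [MeasurableSingletonClass S]
  [IsFiniteMeasure μ]

theorem real_preimage_comp_eq_sum [DecidableEq S'] {f : X → S} (hf : Measurable f) (g : S → S')
    (t : S') : μ.real ((g ∘ f) ⁻¹' {t}) = ∑ s with g s = t, μ.real (f ⁻¹' {s}) := by
  rw [sum_measureReal_preimage_singleton _ fun s _ => hf (measurableSet_singleton s)]
  congr 1
  ext x
  simp

variable [Fintype S'] [Fintype S'']

theorem mapEnt_comp_le {f : X → S} (hf : Measurable f) (g : S → S') :
    mapEnt μ (g ∘ f) ≤ mapEnt μ f := by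
  classical
  rw [mapEnt, mapEnt, ← Finset.sum_fiberwise Finset.univ g]
  refine Finset.sum_le_sum fun t _ => ?_
  rw [real_preimage_comp_eq_sum μ hf]
  exact negMulLog_sum_le _ fun _ _ => measureReal_nonneg

theorem mapEnt_le_of_factorsThrough [Nonempty X] {f : X → S} {g : X → S'} (hf : Measurable f)
    (h : g.FactorsThrough f) : mapEnt μ g ≤ mapEnt μ f := by
  have : Nonempty S' := ⟨g (Classical.arbitrary X)⟩
  rw [← h.extend_comp (fun _ => Classical.arbitrary S')]
  exact mapEnt_comp_le μ hf _

theorem mapEnt_submod [MeasurableSpace S'] [MeasurableSingletonClass S']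
    {f : X → S} {g : X → S'} (hf : Measurable f) (hg : Measurable g)
    (φ : S' → S'') :
    mapEnt μ (fun x => (f x, g x)) + mapEnt μ (φ ∘ g) ≤
      mapEnt μ (fun x => (f x, φ (g x))) + mapEnt μ g := by
  classical
  have hfg : Measurable fun x => (f x, g x) := hf.prodMk hg
  have h1 : ∀ y, μ.real (g ⁻¹' {y}) = ∑ s, μ.real ((fun x => (f x, g x)) ⁻¹' {(s, y)}) := by
    intro y
    have := real_preimage_comp_eq_sum μ hfg Prod.snd y
    rw [Finset.sum_filter, Fintype.sum_prod_type] at this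
    simpa [Function.comp_def] using this
  have h2 : ∀ z, μ.real ((φ ∘ g) ⁻¹' {z}) = ∑ y with φ y = z, μ.real (g ⁻¹' {y}) := fun z =>
    real_preimage_comp_eq_sum μ hg φ z
  have h3 : ∀ s z, μ.real ((fun x => (f x, φ (g x))) ⁻¹' {(s, z)}) =
      ∑ y with φ y = z, μ.real ((fun x => (f x, g x)) ⁻¹' {(s, y)}) := by
    intro s z
    have := real_preimage_comp_eq_sum μ hfg (Prod.map id φ) (s, z)
    rw [Finset.sum_filter, Fintype.sum_prod_type, Finset.sum_eq_single s] at this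
    · simpa [Finset.sum_filter, Function.comp_def] using this
    · intro b _ hb
      simp [hb]
    · simp
  have := sum_negMulLog_submod
    (fun s y => μ.real ((fun x => (f x, g x)) ⁻¹' {(s, y)})) (fun _ _ => measureReal_nonneg) φ
  simp only [mapEnt, Fintype.sum_prod_type, h1, h2, h3] at this ⊢
  exact this

end

theorem mapEnt_comp_measurePreserving {S : Type*} [Fintype S] [MeasurableSpace S]
    [MeasurableSingletonClass S] {f : X → S} (hf : Measurable f) {τ : X → X}
    (hτ : MeasurePreserving τ μ μ) : mapEnt μ (f ∘ τ) = mapEnt μ f := by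
  refine Finset.sum_congr rfl fun s _ => ?_
  rw [preimage_comp, hτ.measureReal_preimage (hf (measurableSet_singleton s)).nullMeasurableSet]

theorem partEnt_eq_mapEnt {S : Type*} [Fintype S] {P : Finset (Set X)} {f : X → S}
    (hP : ∀ A ∈ P, ∀ x ∈ A, A = f ⁻¹' {f x}) (hf : ∀ x, f ⁻¹' {f x} ∈ P) :
    partEnt μ P = mapEnt μ f := by
  have hne : ∀ A : Set X, negMulLog (μ.real A) ≠ 0 → A.Nonempty := by
    intro A hA
    by_contra hA'
    rw [not_nonempty_iff_eq_empty] at hA'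
    simp [hA'] at hA
  symm
  refine Finset.sum_bij_ne_zero (fun s _ _ => f ⁻¹' {s}) ?_ ?_ ?_ fun _ _ _ => rfl
  · intro s _ hs
    obtain ⟨x, rfl⟩ := hne _ hs
    exact hf x
  · intro s _ hs s' _ _ heq
    obtain ⟨x, hx⟩ := hne _ hs
    have hx' : x ∈ f ⁻¹' {s'} := heq ▸ hx
    exact hx.symm.trans hx'
  · intro A hA hA'
    obtain ⟨x, hx⟩ := hne A hA'
    have := hP A hA x hx
    exact ⟨f x, Finset.mem_univ _, this ▸ hA', this.symm⟩

end Entropy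

section Itinerary

variable {X V L : Type*}

/-- The itinerary of a point along a finite set of group elements, with respect to the labelling
`c` of the points. -/
def itinerary (T : V → X → X) (c : X → L) (E : Finset V) (x : X) : E → L :=
  fun v => c (T v x)

theorem itinerary_eq_iff {T : V → X → X} {c : X → L} {E : Finset V} {x y : X} :
    itinerary T c E x = itinerary T c E y ↔ ∀ v ∈ E, c (T v x) = c (T v y) := by
  simp [funext_iff, itinerary]

/-- The nonempty elements of the join along `w` are the fibres of the itinerary map. -/
theorem seqJoin_spec [DecidableEq V] {α : Finset (Set X)} {T : V → X → X}
    {w : ℕ → V} {c : X → α}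
    (hc : ∀ (x : X) (A : α), c x = A ↔ x ∈ (A : Set X)) (k : ℕ) :
    (∀ A ∈ seqJoin T w α k, ∀ x ∈ A, A = itinerary T c ((Finset.range k).image w) ⁻¹'
        {itinerary T c ((Finset.range k).image w) x}) ∧
      ∀ x, itinerary T c ((Finset.range k).image w) ⁻¹'
        {itinerary T c ((Finset.range k).image w) x} ∈ seqJoin T w α k := by
  have hfib : ∀ k x, itinerary T c ((Finset.range k).image w) ⁻¹'
      {itinerary T c ((Finset.range k).image w) x} =
      {y | ∀ i < k, c (T (w i) y) = c (T (w i) x)} := by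
    intro k x
    ext y
    simp [itinerary_eq_iff]
  simp only [hfib]
  have hsucc : ∀ k x, {y | ∀ i < k + 1, c (T (w i) y) = c (T (w i) x)} =
      {y | ∀ i < k, c (T (w i) y) = c (T (w i) x)} ∩
        T (w k) ⁻¹' (c (T (w k) x) : Set X) := by
    intro k x
    ext y
    simp only [mem_ofPred_eq, Nat.forall_lt_succ_right, mem_inter_iff, mem_preimage, hc]
  induction k with
  | zero => simp [seqJoin]
  | succ k ih =>
    constructor
    · intro A hA x hx
      simp only [seqJoin, Finset.mem_image, Finset.mem_product, Prod.exists] at hA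
      obtain ⟨P, B, ⟨hP, hB⟩, rfl⟩ := hA
      rw [hsucc, ← ih.1 P hP x hx.1, (hc (T (w k) x) ⟨B, hB⟩).2 hx.2]
    · intro x
      simp only [seqJoin, Finset.mem_image, Finset.mem_product, Prod.exists]
      exact ⟨_, _, ⟨ih.2 x, (c (T (w k) x)).2⟩, (hsucc k x).symm⟩

end Itinerary

section System

variable {X : Type*} [MeasurableSpace X] {V : Type*} {α : Finset (Set X)}

theorem IsPartition.exists_index (hα : IsPartition α) :
    ∃ c : X → α, ∀ (x : X) (A : α), c x = A ↔ x ∈ (A : Set X) := by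
  have hcov : ∀ x, ∃ A : α, x ∈ (A : Set X) := by
    intro x
    obtain ⟨A, hA, hx⟩ := (hα.2.2 ▸ mem_univ x : x ∈ ⋃₀ (α : Set (Set X)))
    exact ⟨⟨A, hA⟩, hx⟩
  choose c hc using hcov
  refine ⟨c, fun x A => ⟨fun h => h ▸ hc x, fun h => ?_⟩⟩
  by_contra hne
  exact disjoint_left.1 (hα.2.1 (c x).2 A.2 fun h' => hne (Subtype.ext h')) (hc x) h

/-- The entropy of the join of the translates of a partition along a finite set. -/
noncomputable def joinEnt [DecidableEq V] {L : Type*} [Fintype L] (μ : Measure X) (T : V → X → X)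
    (c : X → L) (E : Finset V) : ℝ :=
  mapEnt μ (itinerary T c E)

theorem partEnt_seqJoin_eq_joinEnt [DecidableEq V] {μ : Measure X} {T : V → X → X} {w : ℕ → V}
    {c : X → α} (hc : ∀ (x : X) (A : α), c x = A ↔ x ∈ (A : Set X)) (k : ℕ) :
    partEnt μ (seqJoin T w α k) = joinEnt μ T c ((Finset.range k).image w) := by
  have h := seqJoin_spec (T := T) (w := w) hc k
  exact partEnt_eq_mapEnt μ h.1 h.2

theorem measurable_itinerary {L : Type*} [MeasurableSpace L] {T : V → X → X} {c : X → L}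
    (hT : ∀ v, Measurable (T v)) (hc : Measurable c) (E : Finset V) :
    Measurable (itinerary T c E) :=
  measurable_pi_lambda _ fun v => hc.comp (hT v)

theorem isEntropyLike_joinEnt [AddCommGroup V] [DecidableEq V] {μ : Measure X}
    [IsProbabilityMeasure μ] {T : V → X → X} (hadd : ∀ v w, T (v + w) = T v ∘ T w)
    (hT : ∀ v, MeasurePreserving (T v) μ μ) {L : Type*} [Fintype L] [MeasurableSpace L]
    [MeasurableSingletonClass L] {c : X → L} (hc : Measurable c) :
    IsEntropyLike (joinEnt μ T c) := by
  have : Nonempty X := nonempty_of_isProbabilityMeasure μ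
  have hmeas := measurable_itinerary (T := T) (c := c) (fun v => (hT v).measurable) hc
  refine ⟨?_, ?_, ?_, ?_⟩
  · have : ∀ s, itinerary T c (∅ : Finset V) ⁻¹' {s} = univ := fun s => by
      ext x
      simp [eq_iff_true_of_subsingleton]
    simp [joinEnt, mapEnt, this]
  · intro A B hAB
    exact mapEnt_le_of_factorsThrough μ (hmeas B) fun x y hxy =>
      itinerary_eq_iff.2 fun v hv => itinerary_eq_iff.1 hxy v (hAB hv)
  · intro A B w hAB
    have h1 := mapEnt_submod μ (hc.comp (hT w).measurable) (hmeas B)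
      (fun (s : B → L) (v : A) => s ⟨v, hAB v.2⟩)
    have h2 : joinEnt μ T c (insert w B) ≤
        mapEnt μ (fun x => ((c ∘ T w) x, itinerary T c B x)) :=
      mapEnt_le_of_factorsThrough μ ((hc.comp (hT w).measurable).prodMk (hmeas B))
        fun x y hxy => by
          rw [Prod.mk.injEq, itinerary_eq_iff] at hxy
          rw [itinerary_eq_iff, Finset.forall_mem_insert]
          exact hxy
    have h3 : mapEnt μ (fun x => ((c ∘ T w) x, itinerary T c A x)) ≤
        joinEnt μ T c (insert w A) :=
      mapEnt_le_of_factorsThrough μ (hmeas _) fun x y hxy => by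
        rw [itinerary_eq_iff, Finset.forall_mem_insert] at hxy
        rw [Prod.mk.injEq, itinerary_eq_iff]
        exact hxy
    exact (add_le_add_left h2 _).trans (h1.trans (add_le_add_left h3 _))
  · intro v A
    have hcomp : mapEnt μ (itinerary T c A ∘ T v) = joinEnt μ T c A :=
      mapEnt_comp_measurePreserving μ (hmeas A) (hT v)
    have hiff : ∀ x y, itinerary T c (A.image (v + ·)) x = itinerary T c (A.image (v + ·)) y ↔
        (itinerary T c A ∘ T v) x = (itinerary T c A ∘ T v) y := by
      intro x y
      simp only [Function.comp_apply, itinerary_eq_iff, Finset.forall_mem_image, add_comm v, hadd]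
    rw [← hcomp]
    exact le_antisymm
      (mapEnt_le_of_factorsThrough μ ((hmeas A).comp (hT v).measurable) fun x y => (hiff x y).2)
      (mapEnt_le_of_factorsThrough μ (hmeas _) fun x y => (hiff x y).1)

end System

section Limsup

variable {V : Type*} [AddCommGroup V] [DecidableEq V] {h : Finset V → ℝ}

theorem IsEntropyLike.div_mem_Icc (H : IsEntropyLike h) (w : ℕ → V) (k : ℕ) :
    h ((Finset.range k).image w) / k ∈ Icc 0 (h {0}) := by
  refine ⟨div_nonneg (H.nonneg _) (Nat.cast_nonneg k), ?_⟩
  refine div_le_of_le_mul₀ (Nat.cast_nonneg k) (H.nonneg _) ((H.le_card_mul _).trans ?_)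
  rw [mul_comm]
  have : ((Finset.range k).image w).card ≤ k := Finset.card_image_le.trans_eq (Finset.card_range k)
  have h0 := H.nonneg {0}
  gcongr

theorem IsEntropyLike.isBoundedUnder_le (H : IsEntropyLike h) (w : ℕ → V) :
    IsBoundedUnder (· ≤ ·) atTop fun k : ℕ => h ((Finset.range k).image w) / k :=
  isBoundedUnder_of ⟨_, fun k => (H.div_mem_Icc w k).2⟩

theorem IsEntropyLike.isCoboundedUnder_le (H : IsEntropyLike h) (w : ℕ → V) :
    IsCoboundedUnder (· ≤ ·) atTop fun k : ℕ => h ((Finset.range k).image w) / k :=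
  IsBoundedUnder.isCoboundedUnder_le (isBoundedUnder_of ⟨0, fun k => (H.div_mem_Icc w k).1⟩)

theorem IsEntropyLike.limsup_le (H : IsEntropyLike h) (w : ℕ → V) :
    limsup (fun k : ℕ => h ((Finset.range k).image w) / k) atTop ≤ h {0} :=
  limsup_le_of_le (H.isCoboundedUnder_le w) (.of_forall fun k => (H.div_mem_Icc w k).2)

theorem IsEntropyLike.le_limsup (H : IsEntropyLike h) {w : ℕ → V} {c : ℝ}
    (hw : ∀ k : ℕ, c * k ≤ h ((Finset.range k).image w)) :
    c ≤ limsup (fun k : ℕ => h ((Finset.range k).image w) / k) atTop := by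
  refine le_limsup_of_frequently_le (Eventually.frequently ?_) (H.isBoundedUnder_le w)
  filter_upwards [eventually_gt_atTop 0] with k hk
  rw [le_div_iff₀ (Nat.cast_pos.2 hk)]
  exact hw k

theorem IsEntropyLike.limsup_nonpos (H : IsEntropyLike h) (hnull : IsNull h Set.univ)
    (w : ℕ → V) : limsup (fun k : ℕ => h ((Finset.range k).image w) / k) atTop ≤ 0 := by
  refine le_of_forall_pos_le_add fun c hc => ?_
  obtain ⟨C, hC⟩ := H.exists_sublinear_bound hnull (half_pos hc)
  refine limsup_le_of_le (H.isCoboundedUnder_le w) ?_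
  have htend : Tendsto (fun k : ℕ => C / k) atTop (𝓝 0) :=
    tendsto_const_div_atTop_nhds_zero_nat C
  filter_upwards [eventually_gt_atTop 0, htend.eventually_le_const (half_pos hc)] with k hk hk'
  have hk0 : (0 : ℝ) < k := Nat.cast_pos.2 hk
  have hcard : (((Finset.range k).image w).card : ℝ) ≤ k :=
    Nat.cast_le.2 (Finset.card_image_le.trans_eq (Finset.card_range k))
  calc h ((Finset.range k).image w) / k ≤ (C + k * (c / 2)) / k := by
        gcongr
        exact (hC _).trans (by gcongr)
    _ = C / k + c / 2 := by field_simp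
    _ ≤ 0 + c := by linarith

end Limsup

theorem round_mem_Lam (β : ℝ) (m : ℤ) : (m, round (β * m)) ∈ Lam β 1 := by
  have := abs_le.1 (abs_sub_round (β * m))
  constructor <;> dsimp only <;> linarith

open scoped Pointwise in
/-- Two transverse strips span the plane up to a finite set. -/
theorem exists_finset_Lam_add_Lam_add_eq_univ {β₁ β₂ : ℝ} (hβ : β₁ ≠ β₂) :
    ∃ D : Finset (ℤ × ℤ), Lam β₁ 1 + Lam β₂ 1 + (D : Set (ℤ × ℤ)) = Set.univ := by
  set N : ℤ := ⌈|β₁ - β₂| + 1⌉ with hN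
  refine ⟨{0} ×ˢ Finset.Icc (-N) N, eq_univ_of_forall ?_⟩
  rintro ⟨m, n⟩
  have hβ' : β₁ - β₂ ≠ 0 := sub_ne_zero.2 hβ
  set s : ℝ := (n - β₂ * m) / (β₁ - β₂) with hs
  have hs' : (β₁ - β₂) * s = n - β₂ * m := by rw [hs]; field_simp
  set m₁ : ℤ := round s with hm₁
  set n₁ : ℤ := round (β₁ * m₁) with hn₁
  set n₂ : ℤ := round (β₂ * (m - m₁ : ℤ)) with hn₂
  refine ⟨_, ⟨_, round_mem_Lam β₁ m₁, _, round_mem_Lam β₂ (m - m₁), rfl⟩, (0, n - n₁ - n₂), ?_, ?_⟩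
  · have h1 := abs_sub_round (β₁ * m₁)
    have h2 := abs_sub_round (β₂ * (m - m₁ : ℤ))
    rw [← hn₁] at h1
    rw [← hn₂] at h2
    have h3 : |(β₁ - β₂) * (s - m₁)| ≤ |β₁ - β₂| := by
      rw [abs_mul]
      have := abs_sub_round s
      exact mul_le_of_le_one_right (abs_nonneg _) (by linarith)
    have h4 : |((n - n₁ - n₂ : ℤ) : ℝ)| ≤ N := by
      refine le_trans ?_ (Int.le_ceil _)
      have : ((n - n₁ - n₂ : ℤ) : ℝ) = (β₁ - β₂) * (s - m₁) + (β₁ * m₁ - n₁) +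
          (β₂ * (m - m₁ : ℤ) - n₂) := by
        push_cast
        linear_combination -hs'
      rw [this]
      refine (abs_add_le _ _).trans ?_
      have := abs_add_le ((β₁ - β₂) * (s - m₁)) (β₁ * m₁ - n₁)
      linarith
    have h5 : |n - n₁ - n₂| ≤ N := by exact_mod_cast h4
    simpa using abs_le.1 h5
  · simp only [Prod.mk_add_mk, Prod.mk.injEq]
    constructor <;> ring

/-- if some sequence entropy of `α` is positive, then there is at
most one direction `(1,β)` in which the directional sequence entropy
`h^{v,*}_μ(α)` vanishes. -/
theorem at_most_one_null_direction
    {X : Type*} [MetricSpace X] [CompactSpace X] [MeasurableSpace X] [BorelSpace X]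
    (μ : Measure X) [IsProbabilityMeasure μ] (T : ℤ × ℤ → X → X)
    (hT : IsZ2MPS μ T) (α : Finset (Set X)) (hα : IsPartition α)
    (h : ∃ w : ℕ → ℤ × ℤ, Function.Injective w ∧ 0 < seqEnt μ T w α) :
    ∀ β₁ β₂ : ℝ, hStar μ T β₁ α = 0 → hStar μ T β₂ α = 0 → β₁ = β₂ := by
  intro β₁ β₂ h₁ h₂
  obtain ⟨c, hc⟩ := hα.exists_index
  obtain ⟨w, -, hw⟩ := h
  let _ : MeasurableSpace α := ⊤
  have hcm : Measurable c := measurable_to_countable' fun A => by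
    have : c ⁻¹' {A} = (A : Set X) := by
      ext x
      simp [hc]
    rw [this]
    exact hα.1 A A.2
  have H : IsEntropyLike (joinEnt μ T c) := isEntropyLike_joinEnt hT.2.2.1 hT.2.2.2 hcm
  have hseq : ∀ w : ℕ → ℤ × ℤ, seqEnt μ T w α =
      limsup (fun k : ℕ => joinEnt μ T c ((Finset.range k).image w) / k) atTop := fun w => by
    simp only [seqEnt, partEnt_seqJoin_eq_joinEnt hc]
  have hnull : ∀ β, hStar μ T β α = 0 → IsNull (joinEnt μ T c) (Lam β 1) := by
    intro β hβ
    by_contra hn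
    obtain ⟨d, hd, u, hu, hgrowth⟩ := exists_linear_growth_of_not_isNull H.empty hn
    have hle : seqEnt μ T u α ≤ hStar μ T β α :=
      le_ciSup (f := fun w : {w : ℕ → ℤ × ℤ // EnumIn w (Lam β 1)} => seqEnt μ T w.1 α)
        ⟨joinEnt μ T c {0}, by rintro _ ⟨v, rfl⟩; exact (hseq v.1).trans_le (H.limsup_le v.1)⟩
        ⟨u, hu⟩
    have := H.le_limsup hgrowth
    rw [← hseq] at this
    linarith
  by_contra hne
  obtain ⟨D, hD⟩ := exists_finset_Lam_add_Lam_add_eq_univ hne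
  have huniv := H.isNull_add (H.isNull_add (hnull β₁ h₁) (hnull β₂ h₂)) (isNull_coe_finset D)
  rw [hD] at huniv
  rw [hseq] at hw
  exact hw.not_ge (H.limsup_nonpos huniv w)

end Directional
end

section
/- Let $(X,\mathcal{B}_X,\mu,T)$ be a $\mathbb{Z}^2$-MPS, $\vec v=(1,\beta)\in\mathbb{R}^2$ a direction vector and $b\in(0,\infty)$. Let $S=\{(m_i,n_i)\}_{i=1}^\infty\subset\Lambda^{\vec v}(b)$ be an infinite subset such that $\lim_{i\to\infty}\langle g,U_T^{(m_i,n_i)}f\rangle$ exists for all $f,g\in L^2(X,\mathcal{B}_X,\mu)$, and for $f\in L^2$ let $S(f)\in L^2$ be the weak limit, i.e. $\lim_{i\to\infty}\langle g,U_T^{(m_i,n_i)}f\rangle=\langle g,S(f)\rangle$ for all $g$. Then for every finite measurable partition $\alpha$ of $X$ there exists an infinite subset $S'=\{(m'_i,n'_i)\}_{i=1}^\infty$ of $S$ with $\{m'_i\}_{i=1}^\infty$ strictly monotone such that $h^{S'}_\mu(T)\ge\sum_{B\in\alpha}\int_X -S(1_B)\log S(1_B)\,d\mu$. -/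
open MeasureTheory Filter Set
open scoped ENNReal Topology

namespace Directional

noncomputable section

attribute [local instance] Classical.propDecidable

variable {X : Type*} [MeasurableSpace X] {G : Type*}

/-- The two-element partition `{B, Bᶜ}`. -/
def pairPart (B : Set X) : Finset (Set X) := {B, Bᶜ}

/-- The pulled-back partition `T^{-g} α = {T_g⁻¹ A : A ∈ α}`. -/
def pullPart (T : G → X → X) (g : G) (α : Finset (Set X)) : Finset (Set X) :=
  α.image fun A => T g ⁻¹' A

end

noncomputable section

attribute [local instance] Classical.propDecidable

variable {X : Type*} {G : Type*}

/-- The common refinement `η ∨ U⁻¹ α`. -/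
def joinPreimage (U : X → X) (η α : Finset (Set X)) : Finset (Set X) :=
  (η ×ˢ α).image fun p => p.1 ∩ U ⁻¹' p.2

theorem pairwiseDisjoint_inter_preimage {U : X → X} {η α : Finset (Set X)}
    (hη : (η : Set (Set X)).PairwiseDisjoint id) (hα : (α : Set (Set X)).PairwiseDisjoint id) :
    ((η ×ˢ α : Finset (Set X × Set X)) : Set (Set X × Set X)).PairwiseDisjoint
      fun p => p.1 ∩ U ⁻¹' p.2 := by
  rintro ⟨D, B⟩ h ⟨D', B'⟩ h' hne
  simp only [Finset.coe_product, Set.mem_prod, Finset.mem_coe] at h h'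
  by_cases hD : D = D'
  · have hB : B ≠ B' := fun hB => hne (by rw [hD, hB])
    exact ((hα h.2 h'.2 hB).preimage U).mono inter_subset_right inter_subset_right
  · exact (hη h.1 h'.1 hD).mono inter_subset_left inter_subset_left

variable [MeasurableSpace X]

theorem IsPartition.joinPreimage {U : X → X} (hU : Measurable U) {η α : Finset (Set X)}
    (hη : IsPartition η) (hα : IsPartition α) : IsPartition (joinPreimage U η α) := by
  refine ⟨?_, ?_, ?_⟩
  · intro A hA
    obtain ⟨p, hp, rfl⟩ := Finset.mem_image.1 hA
    rw [Finset.mem_product] at hp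
    exact (hη.1 _ hp.1).inter (hU (hα.1 _ hp.2))
  · intro A hA A' hA' hne
    obtain ⟨p, hp, rfl⟩ := Finset.mem_image.1 hA
    obtain ⟨p', hp', rfl⟩ := Finset.mem_image.1 hA'
    exact pairwiseDisjoint_inter_preimage hη.2.1 hα.2.1 (Finset.mem_coe.2 hp)
      (Finset.mem_coe.2 hp') fun h => hne (by rw [h])
  · refine eq_univ_of_forall fun x => ?_
    obtain ⟨D, hD, hxD⟩ := mem_sUnion.1 (hη.2.2 ▸ mem_univ x)
    obtain ⟨B, hB, hxB⟩ := mem_sUnion.1 (hα.2.2 ▸ mem_univ (U x))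
    exact mem_sUnion.2 ⟨_, Finset.mem_coe.2 (Finset.mem_image.2
      ⟨(D, B), Finset.mem_product.2 ⟨hD, hB⟩, rfl⟩), hxD, hxB⟩

theorem isPartition_univ : IsPartition ({Set.univ} : Finset (Set X)) := by
  refine ⟨?_, ?_, ?_⟩ <;> simp

theorem IsPartition.seqJoin {T : G → X → X} (hT : ∀ g, Measurable (T g)) (w : ℕ → G)
    {α : Finset (Set X)} (hα : IsPartition α) (k : ℕ) : IsPartition (seqJoin T w α k) := by
  induction k with
  | zero => exact isPartition_univ
  | succ k ih => exact IsPartition.joinPreimage (hT _) ih hα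

/-- A measurable set is the disjoint union of its traces on the preimage of a partition. -/
theorem IsPartition.sum_measureReal_inter_preimage (μ : Measure X) [IsFiniteMeasure μ]
    {U : X → X} (hU : Measurable U) {α : Finset (Set X)} (hα : IsPartition α)
    {D : Set X} (hD : MeasurableSet D) :
    ∑ B ∈ α, μ.real (D ∩ U ⁻¹' B) = μ.real D := by
  rw [← measureReal_biUnion_finset]
  · congr 1
    rw [← inter_iUnion₂, ← preimage_iUnion₂]
    have : ⋃ i ∈ α, i = univ := by rw [← hα.2.2, sUnion_eq_biUnion]; rfl
    rw [this, preimage_univ, inter_univ]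
  · intro B hB B' hB' hne
    exact ((hα.2.1 hB hB' hne).preimage U).mono inter_subset_right inter_subset_right
  · exact fun B hB => hD.inter (hU (hα.1 B hB))

theorem IsPartition.sum_measureReal (μ : Measure X) [IsProbabilityMeasure μ]
    {α : Finset (Set X)} (hα : IsPartition α) : ∑ B ∈ α, μ.real B = 1 := by
  simpa using hα.sum_measureReal_inter_preimage μ measurable_id MeasurableSet.univ

/-- Conditional entropy of `U⁻¹ α` given `η`. -/
def condEntPreimage (μ : Measure X) (U : X → X) (η α : Finset (Set X)) : ℝ :=
  ∑ D ∈ η, ∑ B ∈ α, μ.real D * Real.negMulLog (μ.real (D ∩ U ⁻¹' B) / μ.real D)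

/-- The chain rule for the entropy of a common refinement. -/
theorem partEnt_joinPreimage (μ : Measure X) [IsFiniteMeasure μ] {U : X → X} (hU : Measurable U)
    {η α : Finset (Set X)} (hη : IsPartition η) (hα : IsPartition α) :
    partEnt μ (joinPreimage U η α) = partEnt μ η + condEntPreimage μ U η α := by
  unfold partEnt joinPreimage condEntPreimage
  rw [Finset.sum_image_of_disjoint (by simp)
    (pairwiseDisjoint_inter_preimage hη.2.1 hα.2.1), Finset.sum_product, ← Finset.sum_add_distrib]
  refine Finset.sum_congr rfl fun D hD => ?_
  change ∑ B ∈ α, Real.negMulLog (μ.real (D ∩ U ⁻¹' B)) = Real.negMulLog (μ.real D) + _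
  have hsum := hα.sum_measureReal_inter_preimage μ hU (hη.1 D hD)
  rcases eq_or_ne (μ.real D) 0 with h0 | h0
  · have (B : Set X) : μ.real (D ∩ U ⁻¹' B) = 0 :=
      le_antisymm ((measureReal_mono inter_subset_left).trans h0.le) measureReal_nonneg
    simp [h0, this]
  · calc ∑ B ∈ α, Real.negMulLog (μ.real (D ∩ U ⁻¹' B))
        = ∑ B ∈ α, (μ.real (D ∩ U ⁻¹' B) / μ.real D * Real.negMulLog (μ.real D)
            + μ.real D * Real.negMulLog (μ.real (D ∩ U ⁻¹' B) / μ.real D)) := by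
          refine Finset.sum_congr rfl fun B _ => ?_
          rw [← Real.negMulLog_mul, mul_div_cancel₀ _ h0]
      _ = _ := by
          rw [Finset.sum_add_distrib, ← Finset.sum_mul, ← Finset.sum_div, hsum, div_self h0,
            one_mul]

theorem condEntPreimage_le_card (μ : Measure X) [IsProbabilityMeasure μ] (U : X → X)
    {η : Finset (Set X)} (hη : IsPartition η) (α : Finset (Set X)) :
    condEntPreimage μ U η α ≤ α.card := by
  calc condEntPreimage μ U η α ≤ ∑ D ∈ η, ∑ B ∈ α, μ.real D := by
        refine Finset.sum_le_sum fun D _ => Finset.sum_le_sum fun B _ => ?_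
        refine mul_le_of_le_one_right measureReal_nonneg ?_
        have h : 0 ≤ μ.real (D ∩ U ⁻¹' B) / μ.real D := by positivity
        linarith [Real.negMulLog_le_one_sub_self h]
    _ = α.card := by
        simp [← Finset.mul_sum, hη.sum_measureReal μ]

/-- Partition entropies along `w` are sums of conditional entropies. -/
theorem partEnt_seqJoin (μ : Measure X) [IsProbabilityMeasure μ] {T : G → X → X}
    (hT : ∀ g, Measurable (T g)) (w : ℕ → G) {α : Finset (Set X)} (hα : IsPartition α) (k : ℕ) :
    partEnt μ (seqJoin T w α k) =
      ∑ i ∈ Finset.range k, condEntPreimage μ (T (w i)) (seqJoin T w α i) α := by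
  induction k with
  | zero => simp [partEnt, seqJoin]
  | succ k ih =>
    rw [Finset.sum_range_succ, ← ih]
    exact partEnt_joinPreimage μ (hT _) (hα.seqJoin hT w k) hα

/-- A lower bound on the successive conditional entropies bounds the sequence entropy. -/
theorem le_seqEnt (μ : Measure X) [IsProbabilityMeasure μ] {T : G → X → X}
    (hT : ∀ g, Measurable (T g)) (w : ℕ → G) {α : Finset (Set X)} (hα : IsPartition α)
    {c : ℕ → ℝ} {L : ℝ} (hc : Tendsto c atTop (𝓝 L))
    (h : ∀ k, c k ≤ condEntPreimage μ (T (w k)) (seqJoin T w α k) α) :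
    L ≤ seqEnt μ T w α := by
  rw [← hc.cesaro.limsup_eq]
  refine limsup_le_limsup (Eventually.of_forall fun k => ?_)
    hc.cesaro.isBoundedUnder_ge.isCoboundedUnder_le
    (isBoundedUnder_of ⟨(α.card : ℝ), fun k => ?_⟩)
  · simp only [partEnt_seqJoin μ hT w hα, div_eq_inv_mul]
    gcongr with i
    exact h i
  · rw [partEnt_seqJoin μ hT w hα]
    refine div_le_of_le_mul₀ (by positivity) (by positivity) ?_
    calc _ ≤ ∑ i ∈ Finset.range k, (α.card : ℝ) :=
          Finset.sum_le_sum fun i _ => condEntPreimage_le_card μ _ (hα.seqJoin hT w i) α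
      _ = _ := by simp [mul_comm]

/-- If each one-step requirement can be met frequently along `w`, some subsequence meets them all:
`R` compares consecutive values of `m`, while `Q` sees the join of the terms chosen before. -/
theorem exists_subseq_seqJoin {T : G → X → X} (hT : ∀ g, Measurable (T g)) (w : ℕ → G)
    (m : ℕ → ℤ) (R : ℤ → ℤ → Prop) {α : Finset (Set X)} (hα : IsPartition α)
    (Q : ℕ → Finset (Set X) → ℕ → Prop)
    (h : ∀ M k η, IsPartition η → ∃ i, R M (m i) ∧ Q k η i) :
    ∃ φ : ℕ → ℕ, (∀ k, R (m (φ k)) (m (φ (k + 1)))) ∧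
      ∀ k, Q k (seqJoin T (w ∘ φ) α k) (φ k) := by
  choose! next hnext using h
  let s : ℕ → ℤ × Finset (Set X) := fun k => Nat.rec (0, {Set.univ})
    (fun k p => (m (next p.1 k p.2), joinPreimage (T (w (next p.1 k p.2))) p.2 α)) k
  let φ : ℕ → ℕ := fun k => next (s k).1 k (s k).2
  have hs (k : ℕ) : (s k).2 = seqJoin T (w ∘ φ) α k := by
    induction k with
    | zero => rfl
    | succ k ih =>
      change joinPreimage (T (w (φ k))) (s k).2 α = _
      rw [ih]; rfl
  have hpart (k : ℕ) : IsPartition (s k).2 := hs k ▸ hα.seqJoin hT _ k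
  exact ⟨φ, fun k => (hnext (s (k + 1)).1 (k + 1) _ (hpart (k + 1))).1,
    fun k => hs k ▸ (hnext (s k).1 k _ (hpart k)).2⟩

/-- Jensen's inequality for `negMulLog`, summed over a partition. -/
theorem IsPartition.integral_negMulLog_le (μ : Measure X) [IsFiniteMeasure μ]
    {η : Finset (Set X)} (hη : IsPartition η) {s : X → ℝ} (hs : Integrable s μ)
    (h0 : ∀ᵐ x ∂μ, 0 ≤ s x) (h1 : ∀ᵐ x ∂μ, s x ≤ 1) :
    ∫ x, Real.negMulLog (s x) ∂μ ≤
      ∑ D ∈ η, μ.real D * Real.negMulLog ((∫ x in D, s x ∂μ) / μ.real D) := by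
  have hint : Integrable (fun x => Real.negMulLog (s x)) μ := by
    refine Integrable.of_bound
      (Real.continuous_negMulLog.comp_aestronglyMeasurable hs.aestronglyMeasurable) 1 ?_
    filter_upwards [h0, h1] with x hx0 hx1
    rw [Real.norm_of_nonneg (Real.negMulLog_nonneg hx0 hx1)]
    linarith [Real.negMulLog_le_one_sub_self hx0]
  have huniv : ⋃ D ∈ η, D = univ := by rw [← hη.2.2, sUnion_eq_biUnion]; rfl
  rw [← setIntegral_univ, ← huniv, integral_biUnion_finset η hη.1 hη.2.1
    fun D _ => hint.integrableOn]
  refine Finset.sum_le_sum fun D _ => ?_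
  rcases eq_or_ne (μ D) 0 with hD | hD
  · simp [Measure.real, hD, Measure.restrict_eq_zero.2 hD]
  · have hpos : 0 < μ.real D := ENNReal.toReal_pos hD (measure_ne_top μ D)
    have hJ := Real.concaveOn_negMulLog.le_map_set_average
      Real.continuous_negMulLog.continuousOn isClosed_Ici hD (measure_ne_top μ D)
      (ae_restrict_of_ae h0) hs.integrableOn hint.integrableOn
    rw [setAverage_eq, setAverage_eq, smul_eq_mul, smul_eq_mul, ← div_eq_inv_mul,
      ← div_eq_inv_mul, div_le_iff₀' hpos] at hJ
    exact hJ

/-- If `1_B ∘ U i` converges weakly to `s B` for each `B ∈ α`, the conditional entropies of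
`(U i)⁻¹ α` are eventually almost as large as the entropy of the limits. -/
theorem eventually_lt_condEntPreimage (μ : Measure X) [IsFiniteMeasure μ]
    {ι : Type*} {l : Filter ι} [l.NeBot] {U : ι → X → X} {α η : Finset (Set X)}
    (hη : IsPartition η) (s : Set X → X → ℝ) (hs : ∀ B ∈ α, Integrable (s B) μ)
    (hlim : ∀ B ∈ α, ∀ D, MeasurableSet D →
      Tendsto (fun i => μ.real (D ∩ U i ⁻¹' B)) l (𝓝 (∫ x in D, s B x ∂μ)))
    {c : ℝ} (hc : c < ∑ B ∈ α, ∫ x, Real.negMulLog (s B x) ∂μ) :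
    ∀ᶠ i in l, c < condEntPreimage μ (U i) η α := by
  have h0 (B) (hB : B ∈ α) : ∀ᵐ x ∂μ, 0 ≤ s B x :=
    ae_nonneg_of_forall_setIntegral_nonneg (hs B hB) fun D hD _ =>
      ge_of_tendsto' (hlim B hB D hD) fun i => measureReal_nonneg
  have h1 (B) (hB : B ∈ α) : ∀ᵐ x ∂μ, s B x ≤ 1 :=
    ae_le_of_forall_setIntegral_le (hs B hB) (integrable_const (1 : ℝ)) fun D hD _ => by
      rw [setIntegral_const, smul_eq_mul, mul_one]
      exact le_of_tendsto' (hlim B hB D hD) fun i => measureReal_mono inter_subset_left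
  have hT : Tendsto (fun i => condEntPreimage μ (U i) η α) l
      (𝓝 (∑ D ∈ η, ∑ B ∈ α,
        μ.real D * Real.negMulLog ((∫ x in D, s B x ∂μ) / μ.real D))) :=
    tendsto_finsetSum _ fun D hD => tendsto_finsetSum _ fun B hB =>
      ((Real.continuous_negMulLog.tendsto _).comp
        ((hlim B hB D (hη.1 D hD)).div_const _)).const_mul _
  refine hT.eventually_const_lt (hc.trans_le ?_)
  rw [Finset.sum_comm]
  exact Finset.sum_le_sum fun B hB => hη.integral_negMulLog_le μ (hs B hB) (h0 B hB) (h1 B hB)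

end

theorem Lam_fst_preimage_finite (β b : ℝ) (N M : ℤ) :
    {p : ℤ × ℤ | p ∈ Lam β b ∧ p.1 ∈ Icc N M}.Finite := by
  have hcover : {p : ℤ × ℤ | p ∈ Lam β b ∧ p.1 ∈ Icc N M} ⊆
      ⋃ i ∈ Icc N M, ({i} : Set ℤ) ×ˢ Icc ⌊β * i - b / 2⌋ ⌈β * i + b / 2⌉ := by
    rintro ⟨i, j⟩ ⟨⟨h1, h2⟩, hi⟩
    refine mem_biUnion hi ⟨rfl, ?_, ?_⟩
    · exact_mod_cast (Int.floor_le _).trans h1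
    · exact_mod_cast h2.trans (Int.le_ceil _)
  exact ((finite_Icc N M).biUnion fun i _ =>
    (finite_singleton i).prod (finite_Icc _ _)).subset hcover

/-- The first coordinates of an infinite sequence in a strip are unbounded above or below. -/
theorem EnumIn.frequently_lt_fst_or {β b : ℝ} {w : ℕ → ℤ × ℤ} (hw : EnumIn w (Lam β b)) :
    (∀ M, ∃ᶠ i in atTop, M < (w i).1) ∨ ∀ M, ∃ᶠ i in atTop, (w i).1 < M := by
  by_contra! h
  obtain ⟨⟨M, hM⟩, N, hN⟩ := h
  have hfin : (w ⁻¹' {p : ℤ × ℤ | p ∈ Lam β b ∧ p.1 ∈ Icc N M}).Finite :=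
    (Lam_fst_preimage_finite β b N M).preimage hw.1.injOn
  have hout : ∀ᶠ i in atTop, i ∉ w ⁻¹' {p : ℤ × ℤ | p ∈ Lam β b ∧ p.1 ∈ Icc N M} := by
    rw [← Nat.cofinite_eq_atTop]
    exact hfin.compl_mem_cofinite
  obtain ⟨i, hMi, hNi, hi⟩ := (hM.and (hN.and hout)).exists
  exact hi ⟨hw.2 i, hNi, hMi⟩

theorem integral_indicatorConstLp_mul_comp {X : Type*} [MeasurableSpace X] (μ : Measure X)
    [IsFiniteMeasure μ] {U : X → X} (hU : MeasurePreserving U μ μ) {D B : Set X}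
    (hD : MeasurableSet D) (hB : MeasurableSet B) :
    ∫ x, indicatorConstLp 2 hD (measure_ne_top μ D) (1 : ℝ) x *
      indicatorConstLp 2 hB (measure_ne_top μ B) (1 : ℝ) (U x) ∂μ = μ.real (D ∩ U ⁻¹' B) := by
  rw [← integral_indicator_one (hD.inter (hU.measurable hB)), inter_indicator_one]
  refine integral_congr_ae ?_
  filter_upwards [indicatorConstLp_coeFn (p := 2) (hs := hD) (hμs := measure_ne_top μ D)
    (c := (1 : ℝ)), hU.quasiMeasurePreserving.ae (indicatorConstLp_coeFn (p := 2) (hs := hB)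
      (hμs := measure_ne_top μ B) (c := (1 : ℝ)))] with x h1 h2
  rw [h1, h2]
  rfl

theorem integral_indicatorConstLp_mul {X : Type*} [MeasurableSpace X] (μ : Measure X)
    [IsFiniteMeasure μ] {D : Set X} (hD : MeasurableSet D) (f : X → ℝ) :
    ∫ x, indicatorConstLp 2 hD (measure_ne_top μ D) (1 : ℝ) x * f x ∂μ = ∫ x in D, f x ∂μ := by
  rw [← integral_indicator hD]
  refine integral_congr_ae ?_
  filter_upwards [indicatorConstLp_coeFn (p := 2) (hs := hD) (hμs := measure_ne_top μ D)
    (c := (1 : ℝ))] with x h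
  by_cases hx : x ∈ D <;> simp [h, hx]

/-- if `Sf f` is the weak limit of `U_T^{w_i} f` along `S`, then
some subsequence `S'` of `S` with strictly monotone first coordinates has
sequence entropy at least `∑_{B ∈ α} ∫ -S(1_B) log S(1_B) dμ`. -/
theorem seqEnt_ge_weak_limit_entropy
    {X : Type*} [MetricSpace X] [CompactSpace X] [MeasurableSpace X] [BorelSpace X]
    (μ : Measure X) [IsProbabilityMeasure μ] (T : ℤ × ℤ → X → X)
    (hT : IsZ2MPS μ T) (β b : ℝ) (hb : 0 < b)
    (w : ℕ → ℤ × ℤ) (hw : EnumIn w (Lam β b))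
    (Sf : Lp ℝ 2 μ → Lp ℝ 2 μ)
    (hS : ∀ f g : Lp ℝ 2 μ,
      Tendsto (fun i => ∫ x, g x * f (T (w i) x) ∂μ) atTop
        (𝓝 (∫ x, g x * Sf f x ∂μ)))
    (α : Finset (Set X)) (hα : IsPartition α) :
    ∃ φ : ℕ → ℕ, Function.Injective φ ∧
      (StrictMono (fun i => (w (φ i)).1) ∨ StrictAnti (fun i => (w (φ i)).1)) ∧
      ENNReal.ofReal
        (∑ B ∈ α.attach,
          ∫ x, Real.negMulLog
            (Sf (indicatorConstLp 2 (hα.1 B.1 B.2) (measure_ne_top μ B.1) (1 : ℝ)) x) ∂μ)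
        ≤ seqEntSup μ T (w ∘ φ) := by
  obtain ⟨hcont, -, -, hmp⟩ := hT
  have hmeas (g) : Measurable (T g) := (hcont g).measurable
  classical
  let s : Set X → X → ℝ := fun B => if hB : MeasurableSet B then
    Sf (indicatorConstLp 2 hB (measure_ne_top μ B) (1 : ℝ)) else 0
  have hs_eq (B) (hB : MeasurableSet B) :
      s B = Sf (indicatorConstLp 2 hB (measure_ne_top μ B) (1 : ℝ)) := dif_pos hB
  have hs (B) (hB : B ∈ α) : Integrable (s B) μ := by
    rw [hs_eq B (hα.1 B hB)]
    exact (Lp.memLp _).integrable (by norm_num)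
  have hlim (B) (hB : B ∈ α) (D) (hD : MeasurableSet D) :
      Tendsto (fun i => μ.real (D ∩ T (w i) ⁻¹' B)) atTop (𝓝 (∫ x in D, s B x ∂μ)) := by
    have h := hS (indicatorConstLp 2 (hα.1 B hB) (measure_ne_top μ B) (1 : ℝ))
      (indicatorConstLp 2 hD (measure_ne_top μ D) (1 : ℝ))
    simp only [integral_indicatorConstLp_mul_comp μ (hmp _)] at h
    rwa [integral_indicatorConstLp_mul, ← hs_eq B (hα.1 B hB)] at h
  set L : ℝ := ∑ B ∈ α, ∫ x, Real.negMulLog (s B x) ∂μ with hL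
  have hLα : ∑ B ∈ α.attach, ∫ x, Real.negMulLog
      (Sf (indicatorConstLp 2 (hα.1 B.1 B.2) (measure_ne_top μ B.1) (1 : ℝ)) x) ∂μ = L := by
    rw [hL, ← Finset.sum_attach α]
    exact Finset.sum_congr rfl fun B _ => by rw [hs_eq B.1 (hα.1 B.1 B.2)]
  let c : ℕ → ℝ := fun k => L - 1 / ((k : ℝ) + 1)
  have hc : Tendsto c atTop (𝓝 L) := by
    simpa [c] using tendsto_one_div_add_atTop_nhds_zero_nat.const_sub L
  have hsub (R : ℤ → ℤ → Prop) (hR : ∀ M, ∃ᶠ i in atTop, R M (w i).1) :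
      ∃ φ : ℕ → ℕ, (∀ k, R (w (φ k)).1 (w (φ (k + 1))).1) ∧
        ENNReal.ofReal L ≤ seqEntSup μ T (w ∘ φ) := by
    obtain ⟨φ, hφ, hent⟩ := exists_subseq_seqJoin hmeas w (fun i => (w i).1) R hα
      (fun k η i => c k < condEntPreimage μ (T (w i)) η α) fun M k η hη =>
        ((hR M).and_eventually (eventually_lt_condEntPreimage μ hη s hs hlim
          (sub_lt_self L (Nat.one_div_pos_of_nat (n := k))))).exists
    exact ⟨φ, hφ, (ENNReal.ofReal_le_ofReal
      (le_seqEnt μ hmeas (w ∘ φ) hα hc fun k => (hent k).le)).trans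
        (le_iSup (fun α : {α : Finset (Set X) // IsPartition α} =>
          ENNReal.ofReal (seqEnt μ T (w ∘ φ) α)) ⟨α, hα⟩)⟩
  rw [hLα]
  rcases hw.frequently_lt_fst_or with h | h
  · obtain ⟨φ, hφ, hent⟩ := hsub (· < ·) h
    have hmono : StrictMono (fun i => (w (φ i)).1) := strictMono_nat_of_lt_succ hφ
    exact ⟨φ, (hmono.injective.of_comp (f := fun j => (w j).1)), Or.inl hmono, hent⟩
  · obtain ⟨φ, hφ, hent⟩ := hsub (· > ·) h
    have hanti : StrictAnti (fun i => (w (φ i)).1) := strictAnti_nat_of_succ_lt hφ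
    exact ⟨φ, (hanti.injective.of_comp (f := fun j => (w j).1)), Or.inr hanti, hent⟩

end Directional
end

section
/- Let $(X,\mathcal{B}_X,\mu,T)$ be a $\mathbb{Z}^2$-MPS, $\vec v=(1,\beta)\in\mathbb{R}^2$ a direction vector and $b\in(0,\infty)$. For every finite measurable partition $\alpha$ of $X$ all of whose elements belong to $\mathcal{K}^{\vec v}_\mu$, and every infinite subset $S=\{(m_i,n_i)\}_{i=1}^\infty$ of $\Lambda^{\vec v}(b)$, one has $h^S_\mu(T,\alpha)=0$. -/
open MeasureTheory Filter Set
open scoped ENNReal Topology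

namespace Directional

noncomputable section

attribute [local instance] Classical.propDecidable

variable {X : Type*} [MeasurableSpace X] {G : Type*}

section Gibbs

/-- Gibbs' inequality with an unnormalised reference weight `q`. -/
theorem sum_negMulLog_le_of_weight {S : Type*} [Fintype S] (p q : S → ℝ)
    (hp : ∀ s, 0 ≤ p s) (hp1 : ∑ s, p s = 1) (hq : ∀ s, 0 < q s) :
    ∑ s, Real.negMulLog (p s) ≤ ∑ s, p s * (-Real.log (q s)) + Real.log (∑ s, q s) := by
  have hS : Nonempty S := by
    by_contra h
    rw [not_nonempty_iff] at h
    simp at hp1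
  set Q := ∑ s, q s with hQ
  have hQ0 : 0 < Q := Finset.sum_pos (fun s _ => hq s) Finset.univ_nonempty
  have key : ∀ s, Real.negMulLog (p s) ≤
      p s * (-Real.log (q s)) + p s * Real.log Q + (q s / Q - p s) := by
    intro s
    rcases (hp s).eq_or_lt with h | h
    · rw [← h]
      simp only [Real.negMulLog_zero, zero_mul, zero_add, sub_zero]
      exact (div_pos (hq s) hQ0).le
    · have h1 := Real.log_le_sub_one_of_pos (div_pos (hq s) (mul_pos h hQ0))
      rw [Real.log_div (hq s).ne' (mul_pos h hQ0).ne', Real.log_mul h.ne' hQ0.ne'] at h1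
      have h2 := mul_le_mul_of_nonneg_left h1 h.le
      have h3 : p s * (q s / (p s * Q) - 1) = q s / Q - p s := by
        field_simp
      rw [h3] at h2
      rw [Real.negMulLog]
      linarith
  refine (Finset.sum_le_sum fun s _ => key s).trans ?_
  rw [Finset.sum_add_distrib, Finset.sum_add_distrib, Finset.sum_sub_distrib, ← Finset.sum_mul,
    ← Finset.sum_div, hp1, ← hQ, div_self hQ0.ne']
  linarith

/-- If the random string `L` can be predicted, up to errors of small probability at each letter,
from a code in the finite set `Γ`, then its entropy is small. -/
theorem sum_negMulLog_le_of_predict (μ : Measure X) [IsProbabilityMeasure μ]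
    {A Γ : Type*} [Fintype A] [Fintype Γ] (k : ℕ) (L : X → Fin k → A)
    (hL : ∀ i a, MeasurableSet {x | L x i = a}) (C : X → Γ) (π : Fin k → Γ → A)
    (bad : Fin k → Set X) (hbad : ∀ i, MeasurableSet (bad i)) {ε : ℝ}
    (hε : ∀ i, μ.real (bad i) ≤ ε) (hC : ∀ i x, x ∉ bad i → L x i = π i (C x))
    {δ : ℝ} (hδ : 0 < δ) (hδ1 : δ ≤ 1) :
    ∑ s, Real.negMulLog (μ.real (L ⁻¹' {s})) ≤
      Real.log (Fintype.card Γ) + k * (Fintype.card A * δ + ε * (-Real.log δ)) := by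
  let _ : MeasurableSpace A := ⊤
  have hX : Nonempty X := nonempty_of_isProbabilityMeasure μ
  have hΓ : Nonempty Γ := hX.map C
  have hLm : Measurable L := by
    refine measurable_pi_iff.2 fun i => measurable_to_countable' fun a => ?_
    exact hL i a
  set ρ : A → A → ℝ := fun a a' => if a = a' then 1 else δ with hρ
  have hρ0 : ∀ a a', 0 < ρ a a' := fun a a' => by simp only [hρ]; split_ifs <;> linarith
  set q : (Fin k → A) → ℝ := fun s => ∑ c, ∏ i, ρ (s i) (π i c) with hq
  have hq0 : ∀ s, 0 < q s := fun s =>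
    Finset.sum_pos (fun c _ => Finset.prod_pos fun i _ => hρ0 _ _) Finset.univ_nonempty
  have hρsum : ∀ a', ∑ a, ρ a a' ≤ Real.exp (Fintype.card A * δ) := by
    intro a'
    have h1 : ∀ a, ρ a a' ≤ (if a = a' then 1 else 0) + δ := fun a => by
      simp only [hρ]; split_ifs <;> linarith
    refine (Finset.sum_le_sum fun a _ => h1 a).trans ?_
    rw [Finset.sum_add_distrib]
    simp only [Finset.sum_ite_eq', Finset.mem_univ, if_true, Finset.sum_const,
      Finset.card_univ, nsmul_eq_mul]
    linarith [Real.add_one_le_exp (Fintype.card A * δ)]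
  have hQ : ∑ s, q s ≤ Fintype.card Γ * Real.exp (Fintype.card A * δ) ^ k := by
    rw [hq, Finset.sum_comm]
    have : ∀ c : Γ, ∑ s : Fin k → A, ∏ i, ρ (s i) (π i c) ≤
        Real.exp (Fintype.card A * δ) ^ k := by
      intro c
      rw [← Fintype.prod_sum (fun i a => ρ a (π i c))]
      calc ∏ i : Fin k, ∑ a, ρ a (π i c) ≤ ∏ _i : Fin k, Real.exp (Fintype.card A * δ) :=
            Finset.prod_le_prod (fun i _ => Finset.sum_nonneg fun a _ => (hρ0 _ _).le)
              fun i _ => hρsum _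
        _ = Real.exp (Fintype.card A * δ) ^ k := by simp
    refine (Finset.sum_le_sum fun c _ => this c).trans ?_
    simp
  have hp1 : ∑ s, μ.real (L ⁻¹' {s}) = 1 := by
    have := sum_measureReal_preimage_singleton (μ := μ) (Finset.univ : Finset (Fin k → A))
      (f := L) (fun s _ => hLm (measurableSet_singleton s))
    rw [this]
    simp
  have hS : Nonempty (Fin k → A) := hX.map L
  have hlogQ : Real.log (∑ s, q s) ≤ Real.log (Fintype.card Γ) + k * (Fintype.card A * δ) := by
    refine (Real.log_le_log (Finset.sum_pos (fun s _ => hq0 s) Finset.univ_nonempty) hQ).trans ?_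
    rw [Real.log_mul (by simp) (by positivity), Real.log_pow, Real.log_exp]
  have hlogδ : 0 ≤ -Real.log δ := by
    have := Real.log_nonpos hδ.le hδ1
    linarith
  have hpt : ∀ x, -Real.log (q (L x)) ≤
      ∑ i, (bad i).indicator (fun _ => -Real.log δ) x := by
    intro x
    have h1 : ∏ i, ρ (L x i) (π i (C x)) ≤ q (L x) :=
      Finset.single_le_sum (f := fun c => ∏ i, ρ (L x i) (π i c))
        (fun c _ => Finset.prod_nonneg fun i _ => (hρ0 _ _).le) (Finset.mem_univ (C x))
    have h2 := Real.log_le_log (Finset.prod_pos fun i _ => hρ0 _ _) h1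
    rw [Real.log_prod (fun i _ => (hρ0 _ _).ne')] at h2
    refine (neg_le_neg h2).trans ?_
    rw [← Finset.sum_neg_distrib]
    refine Finset.sum_le_sum fun i _ => ?_
    by_cases hx : x ∈ bad i
    · rw [indicator_of_mem hx]
      simp only [hρ]
      split_ifs
      · simpa using hlogδ
      · exact le_rfl
    · rw [indicator_of_notMem hx]
      simp [hρ, hC i x hx]
  have hint : ∑ s, μ.real (L ⁻¹' {s}) * (-Real.log (q s)) ≤ k * (ε * (-Real.log δ)) := by
    have hmap : IsProbabilityMeasure (μ.map L) := Measure.isProbabilityMeasure_map hLm.aemeasurable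
    have hf : Integrable (fun s => -Real.log (q s)) (μ.map L) := Integrable.of_finite
    have h1 : ∑ s, μ.real (L ⁻¹' {s}) * (-Real.log (q s)) = ∫ x, -Real.log (q (L x)) ∂μ := by
      rw [← integral_map (φ := L) (f := fun s => -Real.log (q s)) hLm.aemeasurable hf.1,
        integral_fintype hf]
      refine Finset.sum_congr rfl fun s _ => ?_
      rw [map_measureReal_apply hLm (measurableSet_singleton s), smul_eq_mul]
    have hi : ∀ i ∈ Finset.univ, Integrable ((bad i).indicator (fun _ => -Real.log δ)) μ :=
      fun i _ => (integrable_const _).indicator (hbad i)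
    rw [h1]
    refine (integral_mono (hf.comp_measurable hLm) (integrable_finsetSum _ hi) hpt).trans ?_
    rw [integral_finsetSum _ hi]
    have h2 : ∀ i, ∫ x, (bad i).indicator (fun _ => -Real.log δ) x ∂μ ≤ ε * (-Real.log δ) := by
      intro i
      rw [integral_indicator_const _ (hbad i), smul_eq_mul]
      exact mul_le_mul_of_nonneg_right (hε i) hlogδ
    refine (Finset.sum_le_sum fun i _ => h2 i).trans ?_
    simp
  refine (sum_negMulLog_le_of_weight _ q (fun s => measureReal_nonneg) hp1 hq0).trans ?_
  linarith

end Gibbs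

section Join

theorem seqJoin_subset_image {X : Type*} (T : G → X → X) (w : ℕ → G) (α : Finset (Set X)) (k : ℕ) :
    seqJoin T w α k ⊆ Finset.univ.image
      fun s : Fin k → α => ⋂ i : Fin k, T (w i) ⁻¹' (s i : Set X) := by
  induction k with
  | zero => simp [seqJoin]
  | succ k ih =>
    intro P hP
    simp only [seqJoin, Finset.mem_image, Finset.mem_product] at hP
    obtain ⟨⟨P', B⟩, ⟨hP', hB⟩, rfl⟩ := hP
    obtain ⟨s, -, rfl⟩ := Finset.mem_image.1 (ih hP')
    refine Finset.mem_image.2 ⟨Fin.snoc (α := fun _ => α) s ⟨B, hB⟩, Finset.mem_univ _, ?_⟩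
    ext x
    simp [Fin.forall_fin_succ']

theorem partEnt_seqJoin_le (μ : Measure X) [IsProbabilityMeasure μ] (T : G → X → X)
    (w : ℕ → G) (α : Finset (Set X)) (k : ℕ) :
    partEnt μ (seqJoin T w α k) ≤ ∑ s : Fin k → α,
      Real.negMulLog (μ.real (⋂ i : Fin k, T (w i) ⁻¹' (s i : Set X))) := by
  have h0 : ∀ P : Set X, 0 ≤ Real.negMulLog (μ.real P) := fun P =>
    Real.negMulLog_nonneg measureReal_nonneg measureReal_le_one
  refine (Finset.sum_le_sum_of_subset_of_nonneg (seqJoin_subset_image T w α k)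
    fun P _ _ => h0 P).trans ?_
  exact Finset.sum_image_le_of_nonneg (f := fun P => Real.negMulLog (μ.real P))
    fun P _ => h0 P

theorem partEnt_nonneg (μ : Measure X) [IsProbabilityMeasure μ] (α : Finset (Set X)) :
    0 ≤ partEnt μ α :=
  Finset.sum_nonneg fun _ _ => Real.negMulLog_nonneg measureReal_nonneg measureReal_le_one

end Join

section Net

/-- A precompact Koopman orbit of `1_B` admits finite nets in measure. -/
theorem exists_finset_net_of_isCompact (μ : Measure X) [IsProbabilityMeasure μ]
    (T : G → X → X) (hT : ∀ g, Measurable (T g)) (Λ : Set G) {B : Set X} (hB : MeasurableSet B)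
    (hc : IsCompact (closure (korbit μ T Λ B))) {ε : ℝ} (hε : 0 < ε) :
    ∃ F : Finset G, ∀ u ∈ Λ, ∃ v ∈ F, μ.real (symmDiff (T u ⁻¹' B) (T v ⁻¹' B)) ≤ ε := by
  have htb : TotallyBounded (korbit μ T Λ B) := hc.totallyBounded.subset subset_closure
  obtain ⟨t, hts, htf, htc⟩ := Metric.finite_approx_of_totallyBounded htb (√ε) (Real.sqrt_pos.2 hε)
  let f : G → Lp ℝ 2 μ := fun u =>
    indicatorConstLp 2 (hT u hB) (measure_ne_top μ _) (1 : ℝ)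
  have hf : ∀ u, (f u : X → ℝ) =ᵐ[μ] fun x => B.indicator (fun _ => (1 : ℝ)) (T u x) :=
    fun u => indicatorConstLp_coeFn
  refine (Λ.eq_empty_or_nonempty).elim (fun h => ⟨∅, by simp [h]⟩) fun ⟨u₀, _⟩ => ?_
  have : Nonempty G := ⟨u₀⟩
  choose! v hv using fun g (hg : g ∈ t) => hts hg
  refine ⟨htf.toFinset.image v, fun u hu => ?_⟩
  obtain ⟨g, hgt, hg⟩ := mem_iUnion₂.1 (htc ⟨u, hu, hf u⟩)
  refine ⟨v g, Finset.mem_image_of_mem _ (htf.mem_toFinset.2 hgt), ?_⟩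
  have hgv : g = f (v g) := Lp.ext ((hv g hgt).2.trans (hf _).symm)
  rw [Metric.mem_ball, hgv, dist_indicatorConstLp_eq_norm, norm_indicatorConstLp (by simp) (by simp)]
    at hg
  simp only [norm_one, one_mul, ENNReal.toReal_ofNat, ← Real.sqrt_eq_rpow] at hg
  exact ((Real.sqrt_lt_sqrt_iff measureReal_nonneg).1 hg).le

/-- Every strip is covered by finitely many vertical translates of the strip of width `1`. -/
theorem exists_add_of_mem_Lam (β b : ℝ) :
    ∃ J : Finset ℤ, ∀ p ∈ Lam β b, ∃ u ∈ Lam β 1, ∃ j ∈ J, p = u + (0, j) := by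
  refine ⟨Finset.Icc (-⌈b / 2 + 1 / 2⌉) ⌈b / 2 + 1 / 2⌉, fun p hp => ?_⟩
  have h := abs_le.1 (abs_sub_round ((p.2 : ℝ) - β * p.1))
  set j := round ((p.2 : ℝ) - β * p.1)
  have hc := Int.le_ceil (b / 2 + 1 / 2)
  obtain ⟨h1, h2⟩ := hp
  refine ⟨(p.1, p.2 - j), ⟨?_, ?_⟩, j, Finset.mem_Icc.2 ⟨?_, ?_⟩, ?_⟩
  · push_cast; linarith
  · push_cast; linarith
  · have : -((⌈b / 2 + 1 / 2⌉ : ℤ) : ℝ) ≤ j := by linarith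
    exact_mod_cast this
  · have : (j : ℝ) ≤ (⌈b / 2 + 1 / 2⌉ : ℤ) := by linarith
    exact_mod_cast this
  · ext <;> simp

theorem exists_finset_net_of_mem_dirKron (μ : Measure X) [IsProbabilityMeasure μ]
    (T : ℤ × ℤ → X → X) (hadd : ∀ v w, T (v + w) = T v ∘ T w)
    (hT : ∀ g, MeasurePreserving (T g) μ μ) (β b : ℝ) {B : Set X} (hB : B ∈ dirKron μ T β 1)
    {ε : ℝ} (hε : 0 < ε) :
    ∃ F : Finset (ℤ × ℤ), ∀ u ∈ Lam β b, ∃ v ∈ F,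
      μ.real (symmDiff (T u ⁻¹' B) (T v ⁻¹' B)) ≤ ε := by
  have hm := fun g => (hT g).measurable
  obtain ⟨F, hF⟩ := exists_finset_net_of_isCompact μ T hm _ hB.1 hB.2 hε
  obtain ⟨J, hJ⟩ := exists_add_of_mem_Lam β b
  refine ⟨(F ×ˢ J).image fun p => p.1 + (0, p.2), fun p hp => ?_⟩
  obtain ⟨u, hu, j, hj, rfl⟩ := hJ p hp
  obtain ⟨v, hv, huv⟩ := hF u hu
  refine ⟨v + (0, j), Finset.mem_image.2 ⟨(v, j), Finset.mem_product.2 ⟨hv, hj⟩, rfl⟩, ?_⟩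
  rw [hadd, hadd, preimage_comp, preimage_comp, ← preimage_symmDiff,
    (hT (0, j)).measureReal_preimage
      (((hm u hB.1).symmDiff (hm v hB.1)).nullMeasurableSet)]
  exact huv

end Net

/-- Along any sequence in the strip, the entropy of the joins grows slower than any linear
function. -/
theorem exists_partEnt_seqJoin_le (μ : Measure X) [IsProbabilityMeasure μ]
    (T : ℤ × ℤ → X → X) (hadd : ∀ v w, T (v + w) = T v ∘ T w)
    (hT : ∀ g, MeasurePreserving (T g) μ μ) (β b : ℝ)
    (α : Finset (Set X)) (hα : IsPartition α) (hmem : ∀ A ∈ α, A ∈ dirKron μ T β 1)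
    (w : ℕ → ℤ × ℤ) (hw : ∀ i, w i ∈ Lam β b) {η : ℝ} (hη : 0 < η) :
    ∃ c : ℝ, ∀ k : ℕ, partEnt μ (seqJoin T w α k) ≤ c + k * η := by
  have hm := fun g => (hT g).measurable
  obtain ⟨hαm, hαd, hαu⟩ := hα
  have hlab : ∀ x : X, ∃ A : α, x ∈ (A : Set X) := fun x => by
    obtain ⟨A, hA, hx⟩ := mem_sUnion.1 (hαu.symm ▸ mem_univ x : x ∈ ⋃₀ (α : Set (Set X)))
    exact ⟨⟨A, hA⟩, hx⟩
  choose a ha using hlab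
  have hX : Nonempty X := nonempty_of_isProbabilityMeasure μ
  have hne : Nonempty α := hX.map a
  have huniq : ∀ x (A : α), x ∈ (A : Set X) → a x = A := fun x A hx => by
    by_contra h
    exact Set.disjoint_left.1
      (hαd (a x).2 A.2 fun h' => h (Subtype.ext h')) (ha x) hx
  set d : ℝ := (Fintype.card α : ℝ) with hd
  have hd0 : 0 < d := by rw [hd]; exact_mod_cast Fintype.card_pos
  obtain ⟨δ, hδ, hδ1, hδη⟩ : ∃ δ : ℝ, 0 < δ ∧ δ ≤ 1 ∧ d * δ ≤ η / 2 := by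
    refine ⟨min 1 (η / 2 / d), lt_min one_pos (by positivity), min_le_left _ _, ?_⟩
    calc d * min 1 (η / 2 / d) ≤ d * (η / 2 / d) :=
          mul_le_mul_of_nonneg_left (min_le_right _ _) hd0.le
      _ = η / 2 := by field_simp
  set l : ℝ := -Real.log δ with hl
  have hl0 : 0 ≤ l := by
    have := Real.log_nonpos hδ.le hδ1
    linarith
  have hε : 0 < η / 2 / (d * (l + 1)) := by positivity
  have hnet : ∀ A : α, ∃ F : Finset (ℤ × ℤ), ∀ i, ∃ v ∈ F,
      μ.real (symmDiff (T (w i) ⁻¹' A) (T v ⁻¹' A)) ≤ η / 2 / (d * (l + 1)) := fun A => by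
    obtain ⟨F, hF⟩ := exists_finset_net_of_mem_dirKron μ T hadd hT β b (hmem A A.2) hε
    exact ⟨F, fun i => hF _ (hw i)⟩
  choose F v hvF hv using hnet
  let Γ := ∀ A : α, F A → Bool
  let code : X → Γ := fun x A g => decide (T g x ∈ (A : Set X))
  let π : ℕ → Γ → α := fun i c =>
    Classical.epsilon fun A => c A ⟨v A i, hvF A i⟩ = true
  let bad : ℕ → Set X := fun i =>
    ⋃ A : α, symmDiff (T (w i) ⁻¹' (A : Set X)) (T (v A i) ⁻¹' (A : Set X))
  have hcode : ∀ i x, x ∉ bad i → a (T (w i) x) = π i (code x) := by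
    intro i x hx
    have h1 : ∀ A : α, (T (w i) x ∈ (A : Set X) ↔ T (v A i) x ∈ (A : Set X)) := by
      intro A
      have := fun h => hx (mem_iUnion.2 ⟨A, h⟩)
      rw [mem_symmDiff] at this
      simp only [mem_preimage] at this
      tauto
    have h2 : code x (π i (code x)) ⟨v _ i, hvF _ i⟩ = true := Classical.epsilon_spec
      (p := fun A : α => code x A ⟨v A i, hvF A i⟩ = true) ⟨a (T (w i) x), by
        simp only [code, decide_eq_true_eq]
        exact (h1 _).1 (ha _)⟩
    exact huniq _ _ ((h1 _).2 (of_decide_eq_true h2))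
  have hbad : ∀ i, μ.real (bad i) ≤ η / 2 / (l + 1) := by
    intro i
    refine (measureReal_iUnion_fintype_le _).trans ((Finset.sum_le_sum fun A _ => hv A i).trans ?_)
    rw [Finset.sum_const, Finset.card_univ, nsmul_eq_mul, ← hd]
    apply le_of_eq
    field_simp
  refine ⟨Real.log (Fintype.card Γ), fun k => ?_⟩
  have hmain := sum_negMulLog_le_of_predict μ k (fun x i => a (T (w i) x))
    (fun i A => by
      have : {x | a (T (w i) x) = A} = T (w i) ⁻¹' (A : Set X) := by
        ext x
        exact ⟨fun h => by rw [mem_preimage, ← h]; exact ha _, huniq _ _⟩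
      rw [this]
      exact hm _ (hαm A A.2))
    code (fun i => π i) (fun i => bad i)
    (fun i => MeasurableSet.iUnion fun A => (hm _ (hαm A A.2)).symmDiff (hm _ (hαm A A.2)))
    (fun i => hbad i) (fun i => hcode i) hδ hδ1
  refine (partEnt_seqJoin_le μ T w α k).trans (le_trans (le_of_eq ?_) (hmain.trans ?_))
  · refine Finset.sum_congr rfl fun s _ => ?_
    congr 2
    ext x
    simp only [mem_iInter, mem_preimage, mem_singleton_iff, funext_iff]
    exact forall_congr' fun i => ⟨huniq _ _, fun h => h ▸ ha _⟩
  · have h1 : η / 2 / (l + 1) * l ≤ η / 2 := by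
      rw [div_mul_eq_mul_div, div_le_iff₀ (by positivity)]
      nlinarith
    have h2 : d * δ + η / 2 / (l + 1) * l ≤ η := by linarith
    have := mul_le_mul_of_nonneg_left h2 (Nat.cast_nonneg (α := ℝ) k)
    linarith

end
/-- a finite measurable partition all of whose elements lie in the
directional Kronecker algebra has zero sequence entropy along every infinite
subset of the strip. -/
theorem seqEnt_zero_of_partition_in_dirKron
    {X : Type*} [MetricSpace X] [CompactSpace X] [MeasurableSpace X] [BorelSpace X]
    (μ : Measure X) [IsProbabilityMeasure μ] (T : ℤ × ℤ → X → X)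
    (hT : IsZ2MPS μ T) (β b : ℝ) (hb : 0 < b)
    (α : Finset (Set X)) (hα : IsPartition α)
    (hmem : ∀ A ∈ α, A ∈ dirKron μ T β 1)
    (w : ℕ → ℤ × ℤ) (hw : EnumIn w (Lam β b)) :
    seqEnt μ T w α = 0 := by
  have hlim : Tendsto (fun k : ℕ => partEnt μ (seqJoin T w α k) / (k : ℝ)) atTop (𝓝 0) := by
    rw [Metric.tendsto_atTop']
    intro η hη
    obtain ⟨c, hc⟩ := exists_partEnt_seqJoin_le μ T hT.2.2.1 hT.2.2.2 β b α hα hmem w hw.2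
      (half_pos hη)
    obtain ⟨N, hN⟩ := exists_nat_gt (c / (η / 2))
    refine ⟨N, fun k hk => ?_⟩
    have hNk : (N : ℝ) < k := by exact_mod_cast hk
    have hk0 : (0 : ℝ) < k := (Nat.cast_nonneg N).trans_lt hNk
    rw [Real.dist_0_eq_abs, abs_of_nonneg (div_nonneg (partEnt_nonneg μ _) hk0.le),
      div_lt_iff₀ hk0]
    rw [div_lt_iff₀ (half_pos hη)] at hN
    have := mul_lt_mul_of_pos_right hNk (half_pos hη)
    linarith [hc k]
  exact hlim.limsup_eq

end Directional
end
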